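/- (Dvoretzky–Rogers type theorem) Let $1 \le q < s$ and $1 \le r \le s$. A Banach space $X$ is finite dimensional if and only if the space of anisotropic $(s,q,r)$-summable sequences in $X$ equals the space of absolutely $q$-summable sequences in $X$. -/

import Mathlib

open scoped BigOperators NNReal ENNReal

noncomputable section

/-- `(xs k)` belongs to `ℓ_r(X*)`. -/
def MemLr (r : ℝ) {X : Type*} [NormedAddCommGroup X] [NormedSpace ℝ X]
    (xs : ℕ → X →L[ℝ] ℝ) : Prop :=
  Summable fun k => ‖xs k‖ ^ r

/-- The `ℓ_r(X*)` norm. -/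
noncomputable def lrNorm (r : ℝ) {X : Type*} [NormedAddCommGroup X] [NormedSpace ℝ X]
    (xs : ℕ → X →L[ℝ] ℝ) : ℝ :=
  (∑' k, ‖xs k‖ ^ r) ^ (1 / r)

/-- Weakly `q`-summable sequences. -/
def WeaklySummable (q : ℝ) {X : Type*} [NormedAddCommGroup X] [NormedSpace ℝ X]
    (x : ℕ → X) : Prop :=
  ∀ f : X →L[ℝ] ℝ, Summable fun j => |f (x j)| ^ q

/-- The weak `ℓ_q` norm. -/
noncomputable def weakNorm (q : ℝ) {X : Type*} [NormedAddCommGroup X] [NormedSpace ℝ X]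
    (x : ℕ → X) : ℝ :=
  ⨆ f : {f : X →L[ℝ] ℝ // ‖f‖ ≤ 1}, (∑' j, |f.1 (x j)| ^ q) ^ (1 / q)

/-- Anisotropic `(s,q,r)`-summable sequences. -/
def AnisoSummable (s q r : ℝ) {X : Type*} [NormedAddCommGroup X] [NormedSpace ℝ X]
    (x : ℕ → X) : Prop :=
  ∀ xs : ℕ → X →L[ℝ] ℝ, MemLr r xs →
    (∀ j, Summable fun k => |xs k (x j)| ^ s) ∧
      Summable fun j => (∑' k, |xs k (x j)| ^ s) ^ (q / s)

/-- The anisotropic `(s,q,r)` norm. -/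
noncomputable def anisoNorm (s q r : ℝ) {X : Type*} [NormedAddCommGroup X] [NormedSpace ℝ X]
    (x : ℕ → X) : ℝ :=
  ⨆ xs : {xs : ℕ → X →L[ℝ] ℝ // MemLr r xs ∧ lrNorm r xs ≤ 1},
    (∑' j, (∑' k, |xs.1 k (x j)| ^ s) ^ (q / s)) ^ (1 / q)

theorem aux_det_smul {n : ℕ} (c : ℝ) (A : EuclideanSpace ℝ (Fin n) →L[ℝ] EuclideanSpace ℝ (Fin n)) :
    (c • A).det = c ^ n * A.det := by
  rw [ContinuousLinearMap.det, ContinuousLinearMap.toLinearMap_smul, LinearMap.det_smul]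
  simp [ContinuousLinearMap.det]

theorem aux_maxT {E : Type*} [NormedAddCommGroup E] [NormedSpace ℝ E] [FiniteDimensional ℝ E]
    {n : ℕ} (hn : Module.finrank ℝ E = n) :
    ∃ T : EuclideanSpace ℝ (Fin n) →L[ℝ] E, ‖T‖ ≤ 1 ∧
      ∀ (D : EuclideanSpace ℝ (Fin n) →L[ℝ] EuclideanSpace ℝ (Fin n)) (c : ℝ), 0 < c →
        ‖T.comp D‖ ≤ c → |D.det| ≤ c ^ n := by
  let e : E ≃L[ℝ] EuclideanSpace ℝ (Fin n) := ContinuousLinearEquiv.ofFinrankEq (by simp [hn])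
  let φ : (EuclideanSpace ℝ (Fin n) →L[ℝ] E) → ℝ := fun S => |((e : E →L[ℝ] _).comp S).det|
  have hφc : Continuous φ := by
    refine continuous_abs.comp (ContinuousLinearMap.continuous_det.comp ?_)
    fun_prop
  have : ProperSpace (EuclideanSpace ℝ (Fin n) →L[ℝ] E) := FiniteDimensional.proper ℝ _
  obtain ⟨T, hT, hmax⟩ := (isCompact_closedBall (0 : EuclideanSpace ℝ (Fin n) →L[ℝ] E) 1).exists_isMaxOn
    ⟨0, by simp⟩ hφc.continuousOn
  have hsc : ∀ (S : EuclideanSpace ℝ (Fin n) →L[ℝ] E) (c : ℝ), 0 < c → ‖S‖ ≤ c → φ S ≤ c ^ n * φ T := by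
    intro S c hc hS
    have h1 : c⁻¹ • S ∈ Metric.closedBall (0 : EuclideanSpace ℝ (Fin n) →L[ℝ] E) 1 := by
      rw [mem_closedBall_zero_iff, norm_smul, norm_inv, Real.norm_of_nonneg hc.le]
      rw [inv_mul_le_iff₀ hc]; simpa using hS
    have h2 : φ (c⁻¹ • S) ≤ φ T := hmax h1
    have h3 : φ (c⁻¹ • S) = (c ^ n)⁻¹ * φ S := by
      simp only [φ]
      rw [ContinuousLinearMap.comp_smul, aux_det_smul, abs_mul, abs_of_pos (by positivity), inv_pow]
    rw [h3, inv_mul_le_iff₀ (by positivity)] at h2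
    exact h2
  have hpos : 0 < φ T := by
    have h := hsc e.symm.toContinuousLinearMap (‖e.symm.toContinuousLinearMap‖ + 1) (by positivity) (by linarith)
    have h1 : φ e.symm.toContinuousLinearMap = 1 := by
      simp [φ, ContinuousLinearMap.det]
    rw [h1] at h
    by_contra h0
    have : (‖e.symm.toContinuousLinearMap‖ + 1) ^ n * φ T ≤ 0 :=
      mul_nonpos_of_nonneg_of_nonpos (by positivity) (not_lt.1 h0)
    linarith
  refine ⟨T, by simpa using hT, fun D c hc hD => ?_⟩
  have h := hsc _ c hc hD
  have h2 : φ (T.comp D) = |D.det| * φ T := by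
    simp only [φ, ContinuousLinearMap.det]
    rw [← abs_mul, mul_comm, ← LinearMap.det_comp]
    rfl
  rw [h2] at h
  exact le_of_mul_le_mul_right h hpos

theorem aux_det_proj {n : ℕ} (F : Submodule ℝ (EuclideanSpace ℝ (Fin n))) :
    (ContinuousLinearMap.id ℝ _ + (3 : ℝ) • F.starProjection).det = 4 ^ Module.finrank ℝ F := by
  have hc : IsCompl F Fᗮ := Submodule.isCompl_orthogonal F
  let e := Submodule.prodEquivOfIsCompl F Fᗮ hc
  have h : ((ContinuousLinearMap.id ℝ _ + (3 : ℝ) • F.starProjection :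
        EuclideanSpace ℝ (Fin n) →L[ℝ] EuclideanSpace ℝ (Fin n)) : EuclideanSpace ℝ (Fin n) →ₗ[ℝ] EuclideanSpace ℝ (Fin n))
      = e.toLinearMap ∘ₗ (LinearMap.prodMap ((4 : ℝ) • LinearMap.id) LinearMap.id) ∘ₗ e.symm.toLinearMap := by
    ext1 x
    obtain ⟨⟨u, v⟩, rfl⟩ := e.surjective x
    have h1 : F.starProjection (u : EuclideanSpace ℝ (Fin n)) = u :=
      Submodule.starProjection_eq_self_iff.2 u.2
    have h2 : F.starProjection (v : EuclideanSpace ℝ (Fin n)) = 0 :=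
      (Submodule.starProjection_apply_eq_zero_iff F).2 v.2
    simp [e, Submodule.coe_prodEquivOfIsCompl', h1, h2]
    module
  rw [ContinuousLinearMap.det, h, LinearMap.det_conj, LinearMap.det_prodMap, LinearMap.det_smul]
  simp

theorem aux_step {E : Type*} [NormedAddCommGroup E] [NormedSpace ℝ E]
    {n : ℕ} (T : EuclideanSpace ℝ (Fin n) →L[ℝ] E) (hT : ‖T‖ ≤ 1)
    (h : ∀ (D : EuclideanSpace ℝ (Fin n) →L[ℝ] EuclideanSpace ℝ (Fin n)) (c : ℝ), 0 < c →
        ‖T.comp D‖ ≤ c → |D.det| ≤ c ^ n)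
    (F : Submodule ℝ (EuclideanSpace ℝ (Fin n))) (hF : n < 2 * Module.finrank ℝ F) :
    ∃ v ∈ F, ‖v‖ = 1 ∧ 1 / 3 ≤ ‖T v‖ := by
  by_contra! hcon
  have hb : ∀ v ∈ F, ‖T v‖ ≤ 1 / 3 * ‖v‖ := by
    intro v hv
    by_cases h0 : v = 0
    · simp [h0]
    have hv0 : 0 < ‖v‖ := norm_pos_iff.2 h0
    have := hcon (‖v‖⁻¹ • v) (F.smul_mem _ hv) (by rw [norm_smul, norm_inv, norm_norm, inv_mul_cancel₀ hv0.ne'])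
    rw [map_smul, norm_smul, norm_inv, norm_norm, inv_mul_lt_iff₀ hv0] at this
    linarith
  have h1 := h (ContinuousLinearMap.id ℝ _ + (3 : ℝ) • F.starProjection) 2 two_pos (by
    refine ContinuousLinearMap.opNorm_le_bound _ (by norm_num) fun x => ?_
    have e1 : (T.comp (ContinuousLinearMap.id ℝ _ + (3 : ℝ) • F.starProjection)) x
      = T x + (3 : ℝ) • T (F.starProjection x) := by simp
    rw [e1]
    have e2 := hb _ (Submodule.starProjection_apply_mem F x)
    have e3 : ‖F.starProjection x‖ ≤ ‖x‖ := Submodule.norm_starProjection_apply_le F x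
    have e4 : ‖T x‖ ≤ ‖x‖ := by simpa using T.le_of_opNorm_le hT x
    refine (norm_add_le _ _).trans ?_
    rw [norm_smul, Real.norm_of_nonneg (by norm_num)]
    linarith)
  rw [aux_det_proj, abs_of_pos (by positivity), show (4:ℝ) = 2 ^ 2 by norm_num, ← pow_mul] at h1
  have := (pow_le_pow_iff_right₀ (one_lt_two : (1:ℝ) < 2)).1 h1
  omega

theorem aux_family {E : Type*} [NormedAddCommGroup E] [NormedSpace ℝ E]
    {n : ℕ} (T : EuclideanSpace ℝ (Fin n) →L[ℝ] E) (hT : ‖T‖ ≤ 1)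
    (h : ∀ (D : EuclideanSpace ℝ (Fin n) →L[ℝ] EuclideanSpace ℝ (Fin n)) (c : ℝ), 0 < c →
        ‖T.comp D‖ ≤ c → |D.det| ≤ c ^ n) (m : ℕ) (hm : 2 * m ≤ n) :
    ∃ u : Fin m → EuclideanSpace ℝ (Fin n), Orthonormal ℝ u ∧ ∀ i, 1 / 3 ≤ ‖T (u i)‖ := by
  induction m with
  | zero => exact ⟨Fin.elim0, ⟨fun i => i.elim0, fun i => i.elim0⟩, fun i => i.elim0⟩
  | succ m ih =>
    obtain ⟨u, hu, hu2⟩ := ih (by omega)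
    let G := Submodule.span ℝ (Set.range u)
    have hG : Module.finrank ℝ G = m := by
      simpa using finrank_span_eq_card hu.linearIndependent
    have hG2 := Submodule.finrank_add_finrank_orthogonal G
    rw [hG, finrank_euclideanSpace_fin] at hG2
    obtain ⟨v, hv, hv1, hv2⟩ := aux_step T hT h Gᗮ (by omega)
    have hvu : ∀ i, inner ℝ v (u i) = 0 := fun i =>
      Submodule.inner_left_of_mem_orthogonal (Submodule.subset_span (Set.mem_range_self i)) hv
    refine ⟨Fin.cons v u, ⟨?_, ?_⟩, ?_⟩
    · intro i; refine Fin.cases ?_ (fun i => ?_) i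
      · simpa using hv1
      · simpa using hu.1 i
    · intro i j hij
      induction i using Fin.cases with
      | zero =>
        induction j using Fin.cases with
        | zero => exact absurd rfl hij
        | succ j => simpa using hvu j
      | succ i =>
        induction j using Fin.cases with
        | zero => simpa [real_inner_comm] using hvu i
        | succ j =>
          simpa using hu.2 (fun hh => hij (by rw [hh]))
    · intro i; refine Fin.cases ?_ (fun i => ?_) i
      · simpa using hv2
      · simpa using hu2 i

theorem aux_DR {X : Type*} [NormedAddCommGroup X] [NormedSpace ℝ X]
    (hX : ¬ FiniteDimensional ℝ X) (m : ℕ) :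
    ∃ x : Fin m → X, (∀ i, 1 / 3 ≤ ‖x i‖ ∧ ‖x i‖ ≤ 1) ∧
      ∀ f : X →L[ℝ] ℝ, ∑ i, (f (x i)) ^ 2 ≤ ‖f‖ ^ 2 := by
  have hrank : ((2 * m : ℕ) : Cardinal) ≤ Module.rank ℝ X := by
    refine (Cardinal.natCast_lt_aleph0).le.trans ?_
    by_contra hlt
    exact hX (Module.rank_lt_aleph0_iff.1 (not_le.1 hlt))
  obtain ⟨w, hw⟩ := exists_linearIndependent_of_le_rank hrank
  have hE : Module.finrank ℝ (Submodule.span ℝ (Set.range w)) = 2 * m := by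
    simpa using finrank_span_eq_card hw
  have : FiniteDimensional ℝ (Submodule.span ℝ (Set.range w)) :=
    FiniteDimensional.span_of_finite ℝ (Set.finite_range w)
  obtain ⟨T, hT, h⟩ := aux_maxT hE
  obtain ⟨u, hu, hu2⟩ := aux_family T hT h m le_rfl
  refine ⟨fun i => (T (u i) : X), fun i => ⟨hu2 i, ?_⟩, fun f => ?_⟩
  · have := T.le_of_opNorm_le hT (u i)
    rw [hu.1 i] at this
    simpa using this
  · let g : EuclideanSpace ℝ (Fin (2*m)) →L[ℝ] ℝ := (f.comp (Submodule.subtypeL _)).comp T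
    let y := (InnerProductSpace.toDual ℝ (EuclideanSpace ℝ (Fin (2*m)))).symm g
    have hy : ∀ z, inner ℝ y z = g z := fun z => InnerProductSpace.toDual_symm_apply
    have hyn : ‖y‖ ≤ ‖f‖ := by
      rw [show ‖y‖ = ‖g‖ from LinearIsometryEquiv.norm_map _ _]
      refine ContinuousLinearMap.opNorm_le_bound _ (norm_nonneg _) fun z => ?_
      refine (f.le_opNorm _).trans ?_
      have := T.le_of_opNorm_le hT z
      gcongr
      simpa using this
    have hb := hu.sum_inner_products_le (s := Finset.univ) y
    calc ∑ i, (f (T (u i) : X)) ^ 2 = ∑ i, ‖inner ℝ (u i) y‖ ^ 2 := by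
          refine Finset.sum_congr rfl fun i _ => ?_
          rw [real_inner_comm, hy, Real.norm_eq_abs, sq_abs]; rfl
      _ ≤ ‖y‖ ^ 2 := hb
      _ ≤ ‖f‖ ^ 2 := by gcongr

theorem aux_lr_ls {X : Type*} [NormedAddCommGroup X] [NormedSpace ℝ X] {s r : ℝ} (hr : 1 ≤ r)
    (hrs : r ≤ s) {xs : ℕ → X →L[ℝ] ℝ} (h : MemLr r xs) : Summable fun k => ‖xs k‖ ^ s := by
  have h0 : ∀ k, 0 ≤ ‖xs k‖ ^ r := fun k => by positivity
  have hr0 : 0 < r := by linarith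
  have hB : ∀ k, ‖xs k‖ ≤ (∑' k, ‖xs k‖ ^ r) ^ (1 / r) := by
    intro k
    rw [one_div, Real.le_rpow_inv_iff_of_pos (norm_nonneg _) (tsum_nonneg h0) hr0]
    exact h.le_tsum k (fun j _ => h0 j)
  refine Summable.of_nonneg_of_le (fun k => by positivity) (fun k => ?_)
    (h.mul_right (((∑' k, ‖xs k‖ ^ r) ^ (1 / r)) ^ (s - r)))
  have e : ‖xs k‖ ^ s = ‖xs k‖ ^ r * ‖xs k‖ ^ (s - r) := by
    rw [← Real.rpow_add_of_nonneg (norm_nonneg _) hr0.le (by linarith)]; congr 1; ring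
  rw [e]
  have : ‖xs k‖ ^ (s - r) ≤ ((∑' k, ‖xs k‖ ^ r) ^ (1 / r)) ^ (s - r) :=
    Real.rpow_le_rpow (norm_nonneg _) (hB k) (by linarith)
  gcongr

theorem aux_pt {X : Type*} [NormedAddCommGroup X] [NormedSpace ℝ X] {s : ℝ} (hs : 0 < s)
    (f : X →L[ℝ] ℝ) (x : X) : |f x| ^ s ≤ ‖f‖ ^ s * ‖x‖ ^ s := by
  rw [← Real.mul_rpow (norm_nonneg _) (norm_nonneg _)]
  exact Real.rpow_le_rpow (abs_nonneg _) (f.le_opNorm x) hs.le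

theorem aux_inner {X : Type*} [NormedAddCommGroup X] [NormedSpace ℝ X] {s : ℝ} (hs : 0 < s)
    {xs : ℕ → X →L[ℝ] ℝ} (h : Summable fun k => ‖xs k‖ ^ s) (x : X) :
    Summable fun k => |xs k x| ^ s :=
  Summable.of_nonneg_of_le (fun k => by positivity) (fun k => aux_pt hs (xs k) x) (h.mul_right _)

theorem aux_abs_aniso {X : Type*} [NormedAddCommGroup X] [NormedSpace ℝ X] {s q r : ℝ}
    (hq : 1 ≤ q) (hqs : q < s) (hr : 1 ≤ r) (hrs : r ≤ s) (x : ℕ → X)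
    (hx : Summable fun j => ‖x j‖ ^ q) : AnisoSummable s q r x := by
  intro xs hxs
  have hs : 0 < s := by linarith
  have hL := aux_lr_ls hr hrs hxs
  refine ⟨fun j => aux_inner hs hL _, ?_⟩
  have hL0 : 0 ≤ ∑' k, ‖xs k‖ ^ s := tsum_nonneg fun k => by positivity
  have hA0 : ∀ j, 0 ≤ ∑' k, |xs k (x j)| ^ s := fun j => tsum_nonneg fun k => by positivity
  refine Summable.of_nonneg_of_le (fun j => Real.rpow_nonneg (hA0 j) _) (fun j => ?_)
    (hx.mul_left ((∑' k, ‖xs k‖ ^ s) ^ (q / s)))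
  have h1 : ∑' k, |xs k (x j)| ^ s ≤ (∑' k, ‖xs k‖ ^ s) * ‖x j‖ ^ s := by
    rw [← tsum_mul_right]
    exact (aux_inner hs hL _).tsum_le_tsum (fun k => aux_pt hs _ _) (hL.mul_right _)
  have h2 : ‖x j‖ ^ q = (‖x j‖ ^ s) ^ (q / s) := by
    rw [← Real.rpow_mul (norm_nonneg _)]; congr 1; field_simp
  rw [h2, ← Real.mul_rpow hL0 (by positivity)]
  exact Real.rpow_le_rpow (hA0 j) h1 (by positivity)

theorem aux_fin {X : Type*} [NormedAddCommGroup X] [NormedSpace ℝ X] [FiniteDimensional ℝ X]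
    {s q r : ℝ} (hq : 1 ≤ q) (hqs : q < s) (hr : 1 ≤ r) (x : ℕ → X)
    (hx : AnisoSummable s q r x) : Summable fun j => ‖x j‖ ^ q := by
  have hs : 0 < s := by linarith
  have hq0 : 0 < q := by linarith
  have hw : ∀ f : X →L[ℝ] ℝ, Summable fun j => |f (x j)| ^ q := by
    intro f
    have h := (hx (fun k => if k = 0 then f else 0) (by
      refine summable_of_ne_finset_zero (s := {0}) fun k hk => ?_
      have : k ≠ 0 := by simpa using hk
      simp [this, Real.zero_rpow (by linarith : r ≠ 0)])).2
    convert h using 2 with j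
    rw [tsum_eq_single 0]
    · simp only [if_true]
      rw [← Real.rpow_mul (abs_nonneg _)]; congr 1; field_simp
    · intro k hk
      simp [hk, Real.zero_rpow hs.ne']
  let φ : X ≃L[ℝ] (Fin (Module.finrank ℝ X) → ℝ) := ContinuousLinearEquiv.ofFinrankEq (by simp)
  have hsum : Summable fun j => ∑ i, |φ (x j) i| ^ q := by
    refine summable_sum fun i _ => ?_
    exact hw ((ContinuousLinearMap.proj i).comp φ.toContinuousLinearMap)
  refine Summable.of_nonneg_of_le (fun j => by positivity) (fun j => ?_)
    (hsum.mul_left (‖φ.symm.toContinuousLinearMap‖ ^ q))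
  have h0 : 0 ≤ ∑ i, |φ (x j) i| ^ q := Finset.sum_nonneg fun i _ => by positivity
  have h1 : ‖φ (x j)‖ ≤ (∑ i, |φ (x j) i| ^ q) ^ q⁻¹ := by
    rw [pi_norm_le_iff_of_nonneg (by positivity)]
    intro i
    rw [Real.le_rpow_inv_iff_of_pos (norm_nonneg _) h0 hq0]
    exact Finset.single_le_sum (f := fun i => |φ (x j) i| ^ q) (fun i _ => by positivity) (Finset.mem_univ i)
  have h2 : ‖φ (x j)‖ ^ q ≤ ∑ i, |φ (x j) i| ^ q := by
    rwa [Real.le_rpow_inv_iff_of_pos (norm_nonneg _) h0 hq0] at h1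
  have h3 : ‖x j‖ ≤ ‖φ.symm.toContinuousLinearMap‖ * ‖φ (x j)‖ := by
    simpa using φ.symm.toContinuousLinearMap.le_opNorm (φ (x j))
  calc ‖x j‖ ^ q ≤ (‖φ.symm.toContinuousLinearMap‖ * ‖φ (x j)‖) ^ q :=
        Real.rpow_le_rpow (norm_nonneg _) h3 hq0.le
    _ = ‖φ.symm.toContinuousLinearMap‖ ^ q * ‖φ (x j)‖ ^ q :=
        Real.mul_rpow (norm_nonneg _) (norm_nonneg _)
    _ ≤ _ := by gcongr

theorem aux_weak {X : Type*} [NormedAddCommGroup X] [NormedSpace ℝ X] {s : ℝ} (hs : 1 ≤ s)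
    {N : ℕ} (x : Fin (4 ^ N) → X) (hx : ∀ i, ‖x i‖ ≤ 1)
    (hf : ∀ f : X →L[ℝ] ℝ, ∑ i, (f (x i)) ^ 2 ≤ ‖f‖ ^ 2) (f : X →L[ℝ] ℝ) :
    ∑ i, |f (x i)| ^ s ≤ 2 ^ N * ‖f‖ ^ s := by
  have h1 : ∑ i, |f (x i)| ≤ 2 ^ N * ‖f‖ := by
    have h := sq_sum_le_card_mul_sum_sq (s := Finset.univ) (f := fun i => |f (x i)|)
    simp only [sq_abs, Finset.card_univ, Fintype.card_fin] at h
    refine abs_le_of_sq_le_sq' ?_ (by positivity) |>.2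
    refine h.trans ?_
    rw [mul_pow, ← pow_mul, mul_comm N 2, pow_mul]
    push_cast
    norm_num
    exact hf f
  have h2 : ∀ i, |f (x i)| ^ s ≤ ‖f‖ ^ (s - 1) * |f (x i)| := by
    intro i
    have hle : |f (x i)| ≤ ‖f‖ := by
      refine (f.le_opNorm (x i)).trans ?_
      exact mul_le_of_le_one_right (norm_nonneg _) (hx i)
    have e : |f (x i)| ^ s = |f (x i)| ^ (s - 1) * |f (x i)| := by
      conv_rhs => rw [← Real.rpow_one (|f (x i)|), ← Real.rpow_mul (abs_nonneg _), one_mul,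
        ← Real.rpow_add_of_nonneg (abs_nonneg _) (by linarith) zero_le_one]
      congr 1; ring
    rw [e]
    have := Real.rpow_le_rpow (abs_nonneg _) hle (by linarith : 0 ≤ s - 1)
    gcongr
  have e : ‖f‖ ^ s = ‖f‖ ^ (s - 1) * ‖f‖ := by
    conv_rhs => rw [← Real.rpow_one ‖f‖, ← Real.rpow_mul (norm_nonneg _), one_mul,
      ← Real.rpow_add_of_nonneg (norm_nonneg _) (by linarith) zero_le_one]
    congr 1; ring
  calc ∑ i, |f (x i)| ^ s ≤ ∑ i, ‖f‖ ^ (s - 1) * |f (x i)| := Finset.sum_le_sum fun i _ => h2 i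
    _ = ‖f‖ ^ (s - 1) * ∑ i, |f (x i)| := by rw [Finset.mul_sum]
    _ ≤ ‖f‖ ^ (s - 1) * (2 ^ N * ‖f‖) := by gcongr
    _ = _ := by rw [e]; ring

theorem aux_block {X : Type*} [NormedAddCommGroup X] [NormedSpace ℝ X] {s q : ℝ} (hq : 1 ≤ q)
    (hqs : q < s) {xs : ℕ → X →L[ℝ] ℝ} (hL : Summable fun k => ‖xs k‖ ^ s)
    {N : ℕ} (x : Fin (4 ^ N) → X) (hx : ∀ i, ‖x i‖ ≤ 1)
    (hf : ∀ f : X →L[ℝ] ℝ, ∑ i, (f (x i)) ^ 2 ≤ ‖f‖ ^ 2) (c : ℝ) (hc : 0 ≤ c)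
    (hcq : c ^ q = (1 / 4) ^ N) :
    ∑ i, (∑' k, |xs k (c • x i)| ^ s) ^ (q / s) ≤
      (∑' k, ‖xs k‖ ^ s) ^ (q / s) * ((1 / 2 : ℝ) ^ (q / s)) ^ N := by
  have hs : 0 < s := by linarith
  have hq0 : 0 < q := by linarith
  set L := ∑' k, ‖xs k‖ ^ s with hLdef
  have hL0 : 0 ≤ L := tsum_nonneg fun k => by positivity
  let A : Fin (4 ^ N) → ℝ := fun i => ∑' k, |xs k (x i)| ^ s
  have hA0 : ∀ i, 0 ≤ A i := fun i => tsum_nonneg fun k => by positivity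
  have hA : ∑ i, A i ≤ 2 ^ N * L := by
    rw [← Summable.tsum_finsetSum (fun i _ => aux_inner hs hL (x i)), hLdef, ← tsum_mul_left]
    exact Summable.tsum_le_tsum (fun k => aux_weak (by linarith) x hx hf (xs k))
      (summable_sum fun i _ => aux_inner hs hL (x i)) (hL.mul_left _)
  have e1 : ∀ i, (∑' k, |xs k (c • x i)| ^ s) ^ (q / s) = (1 / 4) ^ N * (A i) ^ (q / s) := by
    intro i
    have : ∀ k, |xs k (c • x i)| ^ s = c ^ s * |xs k (x i)| ^ s := by
      intro k
      rw [map_smul, smul_eq_mul, abs_mul, abs_of_nonneg hc, Real.mul_rpow hc (abs_nonneg _)]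
    simp_rw [this]
    rw [tsum_mul_left, Real.mul_rpow (by positivity) (hA0 i), ← Real.rpow_mul hc, ← hcq]
    congr 2; field_simp
  simp_rw [e1]
  have hJ := Real.arith_mean_le_rpow_mean Finset.univ (fun _ : Fin (4 ^ N) => (1 / 4 : ℝ) ^ N)
    (fun i => (A i) ^ (q / s)) (fun _ _ => by positivity)
    (by simp) (fun i _ => Real.rpow_nonneg (hA0 i) _)
    (p := s / q) (by rw [le_div_iff₀ hq0]; linarith)
  refine hJ.trans ?_
  have e2 : ∀ i, ((A i) ^ (q / s)) ^ (s / q) = A i := by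
    intro i
    rw [← Real.rpow_mul (hA0 i), show q / s * (s / q) = 1 by field_simp, Real.rpow_one]
  simp_rw [e2]
  rw [← Finset.mul_sum, one_div_div]
  have e3 : ((1 / 2 : ℝ) ^ (q / s)) ^ N = ((1 / 2 : ℝ) ^ N) ^ (q / s) := by
    rw [← Real.rpow_natCast, ← Real.rpow_mul (by norm_num), mul_comm, Real.rpow_mul (by norm_num),
      Real.rpow_natCast]
  rw [e3, ← Real.mul_rpow hL0 (by positivity)]
  refine Real.rpow_le_rpow (mul_nonneg (by positivity) (Finset.sum_nonneg fun i _ => hA0 i)) ?_ (by positivity)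
  calc (1 / 4 : ℝ) ^ N * ∑ i, A i ≤ (1 / 4) ^ N * (2 ^ N * L) := by gcongr
    _ = L * (1 / 2) ^ N := by
      rw [← mul_assoc, ← mul_pow]; norm_num [mul_comm]

theorem aux_inf {X : Type*} [NormedAddCommGroup X] [NormedSpace ℝ X]
    {s q r : ℝ} (hq : 1 ≤ q) (hqs : q < s) (hr : 1 ≤ r) (hrs : r ≤ s)
    (hX : ¬ FiniteDimensional ℝ X) :
    ∃ x : ℕ → X, AnisoSummable s q r x ∧ ¬ Summable fun j => ‖x j‖ ^ q := by
  have hs : 0 < s := by linarith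
  have hq0 : 0 < q := by linarith
  choose x hx hf using fun N : ℕ => aux_DR hX (4 ^ N)
  let c : ℕ → ℝ := fun N => ((1 / 4 : ℝ) ^ N) ^ q⁻¹
  have hc0 : ∀ N, 0 ≤ c N := fun N => by positivity
  have hcq : ∀ N, c N ^ q = (1 / 4) ^ N := fun N =>
    Real.rpow_inv_rpow (by positivity) hq0.ne'
  let y : (Σ N : ℕ, Fin (4 ^ N)) → X := fun p => c p.1 • x p.1 p.2
  have : Infinite (Σ N : ℕ, Fin (4 ^ N)) :=
    Infinite.of_injective (fun N : ℕ => (⟨N, ⟨0, by positivity⟩⟩ : Σ N : ℕ, Fin (4 ^ N)))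
      (fun a b h => congrArg Sigma.fst h)
  obtain ⟨e⟩ : Nonempty (ℕ ≃ (Σ N : ℕ, Fin (4 ^ N))) := nonempty_equiv_of_countable
  refine ⟨y ∘ e, fun xs hxs => ?_, fun hsum => ?_⟩
  · have hL := aux_lr_ls hr hrs hxs
    refine ⟨fun j => aux_inner hs hL _, ?_⟩
    have key : Summable fun p => (∑' k, |xs k (y p)| ^ s) ^ (q / s) := by
      have hnn : ∀ p, 0 ≤ (∑' k, |xs k (y p)| ^ s) ^ (q / s) := fun p =>
        Real.rpow_nonneg (tsum_nonneg fun k => by positivity) _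
      rw [summable_sigma_of_nonneg hnn]
      refine ⟨fun N => Summable.of_finite, ?_⟩
      have hgeo : Summable fun N : ℕ => ((1 / 2 : ℝ) ^ (q / s)) ^ N :=
        summable_geometric_of_lt_one (by positivity)
          (Real.rpow_lt_one (by norm_num) (by norm_num) (by positivity))
      refine Summable.of_nonneg_of_le (fun N => tsum_nonneg fun i => hnn _) (fun N => ?_)
        (hgeo.mul_left ((∑' k, ‖xs k‖ ^ s) ^ (q / s)))
      rw [tsum_fintype]
      exact aux_block hq hqs hL (x N) (fun i => (hx N i).2) (hf N) (c N) (hc0 N) (hcq N)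
    exact (e.summable_iff (f := fun p => (∑' k, |xs k (y p)| ^ s) ^ (q / s))).2 key
  · have h1 : Summable fun p => ‖y p‖ ^ q := (e.summable_iff (f := fun p => ‖y p‖ ^ q)).1 hsum
    rw [summable_sigma_of_nonneg (fun p => by positivity)] at h1
    have h2 := h1.2.tendsto_atTop_zero
    have h3 : ∀ N, (1 / 3 : ℝ) ^ q ≤ ∑' i : Fin (4 ^ N), ‖y ⟨N, i⟩‖ ^ q := by
      intro N
      rw [tsum_fintype]
      calc (1 / 3 : ℝ) ^ q = ∑ i : Fin (4 ^ N), (1 / 4 : ℝ) ^ N * (1 / 3 : ℝ) ^ q := by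
            simp
        _ ≤ _ := by
          refine Finset.sum_le_sum fun i _ => ?_
          simp only [y]
          rw [norm_smul, Real.norm_of_nonneg (hc0 N), Real.mul_rpow (hc0 N) (norm_nonneg _), hcq]
          have := Real.rpow_le_rpow (by norm_num) (hx N i).1 hq0.le
          gcongr
    have h4 := ge_of_tendsto' h2 h3
    have : (0 : ℝ) < (1 / 3 : ℝ) ^ q := by positivity
    linarith

theorem stmt8 {X : Type*} [NormedAddCommGroup X] [NormedSpace ℝ X] [CompleteSpace X]
    {s q r : ℝ} (hq : 1 ≤ q) (hqs : q < s) (hr : 1 ≤ r) (hrs : r ≤ s) :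
    FiniteDimensional ℝ X ↔
      ∀ x : ℕ → X, (AnisoSummable s q r x ↔ Summable fun j => ‖x j‖ ^ q) := by
  constructor
  · intro h x
    exact ⟨aux_fin hq hqs hr x, aux_abs_aniso hq hqs hr hrs x⟩
  · intro h
    by_contra hX
    obtain ⟨x, h1, h2⟩ := aux_inf hq hqs hr hrs hX
    exact h2 ((h x).1 h1)
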